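/- arXiv:1611.03038 — 10 statements merged into one kernel-verified Lean document; each statement's English description precedes it below -/
import Mathlib

section
/- Let p ≥ 1 and let B₁, …, B_p be rational numbers such that for every nonempty subset S of {1, …, p} the sum ∑_{i ∈ S} B_i is nonzero. If y₁, …, y_p are rational numbers satisfying ∑_{i=1}^p B_i · y_iⁿ = 0 for every integer n ≥ 1, then y₁ = y₂ = ⋯ = y_p = 0. -/
/-- If `B₁, …, B_p` are rationals all of whose sums over nonempty index subsets are
nonzero, and `y₁, …, y_p` are rationals with all weighted power sums
`∑ i, B i * y i ^ n` (for `n ≥ 1`) equal to zero, then all `y i` vanish. -/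
theorem weighted_power_sums_vanish (p : ℕ) (hp : 1 ≤ p) (B : Fin p → ℚ)
    (hB : ∀ S : Finset (Fin p), S.Nonempty → ∑ i ∈ S, B i ≠ 0)
    (y : Fin p → ℚ)
    (hy : ∀ n : ℕ, 1 ≤ n → ∑ i : Fin p, B i * y i ^ n = 0) :
    ∀ i, y i = 0 := by
  intro k
  by_contra hk
  have key : ∀ P : Polynomial ℚ, ∑ i, B i * (y i * P.eval (y i)) = 0 := by
    intro P
    induction P using Polynomial.induction_on' with
    | add P Q hP hQ =>
      simp only [Polynomial.eval_add, mul_add, Finset.sum_add_distrib, hP, hQ, add_zero]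
    | monomial n a =>
      have h := hy (n + 1) (by omega)
      calc _ = a * ∑ i, B i * y i ^ (n + 1) := by
            rw [Finset.mul_sum]
            refine Finset.sum_congr rfl fun i _ => ?_
            rw [Polynomial.eval_monomial]
            ring
        _ = 0 := by rw [h, mul_zero]
  let P : Polynomial ℚ :=
    ∏ c ∈ (Finset.univ.image y).erase (y k), (Polynomial.X - Polynomial.C c)
  have hPk : P.eval (y k) ≠ 0 := by
    simp only [P, Polynomial.eval_prod, Polynomial.eval_sub, Polynomial.eval_X, Polynomial.eval_C]
    refine Finset.prod_ne_zero_iff.mpr fun c hc => ?_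
    exact sub_ne_zero.mpr (Finset.ne_of_mem_erase hc).symm
  have hPi : ∀ i, y i ≠ y k → P.eval (y i) = 0 := by
    intro i hi
    simp only [P, Polynomial.eval_prod, Polynomial.eval_sub, Polynomial.eval_X, Polynomial.eval_C]
    exact Finset.prod_eq_zero (i := y i) (by simp [hi]) (sub_self _)
  have hsum : (∑ i ∈ Finset.univ.filter (fun i => y i = y k), B i) * (y k * P.eval (y k)) = 0 := by
    rw [← key P, Finset.sum_mul, Finset.sum_filter]
    refine Finset.sum_congr rfl fun i _ => ?_
    split_ifs with h
    · rw [h]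
    · rw [hPi i h]; simp
  exact mul_ne_zero (hB _ ⟨k, by simp⟩) (mul_ne_zero hk hPk) hsum
end

section
/- Let p ≥ 1 and let B₁, …, B_p be rational numbers such that for every nonempty subset S of {1, …, p} the sum ∑_{i ∈ S} B_i is nonzero. Then the polynomial ring ℚ[y₁, …, y_p] is a finitely generated module over its ℚ-subalgebra generated by the weighted power sums ∑_{i=1}^p B_i · y_iⁿ for n = 1, 2, 3, …; in particular, every y_i is integral over that subalgebra. -/
open MvPolynomial

set_option synthInstance.maxHeartbeats 1000000
set_option maxHeartbeats 1000000

/-- Over a field, if all weighted power sums vanish then no coordinate equals one. -/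
lemma weighted_aux_residue {p : ℕ} {k : Type*} [Field k] (φ : ℚ →+* k) (B : Fin p → ℚ)
    (hB : ∀ S : Finset (Fin p), S.Nonempty → ∑ i ∈ S, B i ≠ 0)
    (z : Fin p → k) (hz : ∀ n : ℕ, 1 ≤ n → ∑ i, φ (B i) * z i ^ n = 0)
    (j : Fin p) (hj : z j = 1) : False := by
  classical
  have h1 : ∀ f : Polynomial k, ∑ i, φ (B i) * (z i * f.eval (z i)) = 0 := by
    intro f
    induction f using Polynomial.induction_on' with
    | add f g hf hg =>
      simp only [Polynomial.eval_add, mul_add, Finset.sum_add_distrib, hf, hg, add_zero]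
    | monomial n a =>
      have := hz (n + 1) (by omega)
      calc _ = a * ∑ i, φ (B i) * z i ^ (n + 1) := by
            rw [Finset.mul_sum]
            refine Finset.sum_congr rfl fun i _ => ?_
            rw [Polynomial.eval_monomial]; ring
        _ = 0 := by rw [this, mul_zero]
  let T : Finset k := (Finset.univ.image z).erase 1
  let f : Polynomial k := ∏ v ∈ T, (Polynomial.X - Polynomial.C v)
  have hf1 : f.eval 1 ≠ 0 := by
    rw [Polynomial.eval_prod, Finset.prod_ne_zero_iff]
    intro v hv
    have := (Finset.mem_erase.1 hv).1
    simpa [sub_eq_zero] using this.symm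
  have hf0 : ∀ i, z i ≠ 1 → f.eval (z i) = 0 := by
    intro i hi
    rw [Polynomial.eval_prod]
    exact Finset.prod_eq_zero (i := z i) (Finset.mem_erase.2 ⟨hi, by simp⟩) (by simp)
  have h2 := h1 f
  have h3 : ∑ i, φ (B i) * (z i * f.eval (z i)) =
      φ (∑ i ∈ Finset.univ.filter (fun i => z i = 1), B i) * f.eval 1 := by
    rw [map_sum, Finset.sum_mul, Finset.sum_filter]
    refine Finset.sum_congr rfl fun i _ => ?_
    split_ifs with h
    · rw [h, one_mul]
    · rw [hf0 i h, mul_zero, mul_zero]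
  rw [h3] at h2
  rcases mul_eq_zero.1 h2 with h | h
  · exact hB _ ⟨j, by simp [hj]⟩ ((map_eq_zero φ).1 h)
  · exact hf1 h

/-- Valuation-theoretic core. -/
lemma weighted_aux_valuation {p : ℕ} {K : Type*} [Field K] (V : ValuationSubring K)
    (φ : ℚ →+* V) (B : Fin p → ℚ)
    (hB : ∀ S : Finset (Fin p), S.Nonempty → ∑ i ∈ S, B i ≠ 0)
    (y : Fin p → K) (hy : ∀ n : ℕ, 1 ≤ n → ∑ i, (φ (B i) : K) * y i ^ n ∈ V)
    (i₀ : Fin p) : y i₀ ∈ V := by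
  by_contra hi
  obtain ⟨j, -, hj⟩ := Finset.exists_max_image Finset.univ (fun i => V.valuation (y i))
    ⟨i₀, Finset.mem_univ _⟩
  have hj1 : 1 < V.valuation (y j) := by
    rw [← V.valuation_le_one_iff, not_le] at hi
    exact hi.trans_le (hj i₀ (Finset.mem_univ _))
  have hj0 : y j ≠ 0 := by
    intro h
    rw [h, map_zero] at hj1
    exact absurd hj1 (by simp)
  have hinv : V.valuation (y j)⁻¹ < 1 := by
    rw [map_inv₀]
    exact inv_lt_one_of_one_lt₀ hj1
  have hz : ∀ i, ∃ a : V, (a : K) * y j = y i := fun i =>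
    (V.valuation_le_iff _ _).1 (hj i (Finset.mem_univ _))
  choose z hz using hz
  refine weighted_aux_residue ((IsLocalRing.residue V).comp φ) B hB
    (fun i => IsLocalRing.residue V (z i)) ?_ j ?_
  · intro n hn
    have : IsLocalRing.residue V (∑ i, φ (B i) * z i ^ n) = 0 := by
      rw [IsLocalRing.residue_eq_zero_iff, V.valuation_lt_one_iff]
      have e : ((∑ i, φ (B i) * z i ^ n : V) : K) =
          (∑ i, (φ (B i) : K) * y i ^ n) * ((y j)⁻¹) ^ n := by
        push_cast
        rw [Finset.sum_mul]
        refine Finset.sum_congr rfl fun i _ => ?_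
        rw [← hz i, mul_pow, mul_assoc, mul_assoc, ← mul_pow (y j), mul_inv_cancel₀ hj0, one_pow,
          mul_one]
      rw [e, map_mul, map_pow]
      exact (mul_le_of_le_one_left' ((V.valuation_le_one_iff _).2 (hy n hn))).trans_lt
        (pow_lt_one₀ zero_le hinv (by omega))
    simp only [map_sum, map_mul, map_pow] at this
    exact this
  · have : z j = 1 := by
      apply Subtype.ext
      exact mul_right_cancel₀ hj0 ((hz j).trans (one_mul _).symm)
    simp [this]

lemma weighted_aux_integral (p : ℕ) (B : Fin p → ℚ)
    (hB : ∀ S : Finset (Fin p), S.Nonempty → ∑ i ∈ S, B i ≠ 0)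
    (A : Subalgebra ℚ (MvPolynomial (Fin p) ℚ))
    (hA : ∀ n : ℕ, 1 ≤ n → ∑ i : Fin p, C (B i) * X i ^ n ∈ A) (i : Fin p) :
    IsIntegral A (X i : MvPolynomial (Fin p) ℚ) := by
  let K := FractionRing (MvPolynomial (Fin p) ℚ)
  let f : MvPolynomial (Fin p) ℚ →+* K := algebraMap _ K
  have hf : Function.Injective f := IsFractionRing.injective _ K
  let R : Subring K := A.toSubring.map f
  have key : f (X i) ∈ (integralClosure (Subring.closure (R : Set K)) K).toSubring := by
    rw [← iInf_valuationSubring_superset, Subring.mem_iInf]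
    rintro ⟨V, hV⟩
    have hmem : ∀ a ∈ A, f a ∈ V := fun a ha => hV ⟨a, ha, rfl⟩
    let φ : ℚ →+* V := (f.comp C).codRestrict V.toSubring
      (fun q => hmem _ (A.algebraMap_mem q))
    refine weighted_aux_valuation V φ B hB (fun i => f (X i)) ?_ i
    intro n hn
    have := hmem _ (hA n hn)
    rw [map_sum] at this
    simp only [map_mul, map_pow] at this
    exact this
  rw [Subring.closure_eq] at key
  have key2 : IsIntegral R (f (X i)) := key
  let e : A.toSubring ≃+* R := A.toSubring.equivMapOfInjective f hf
  have key3 : IsIntegral A (f (X i)) := by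
    refine key2.map_of_comp_eq (e.symm : R →+* A.toSubring) (RingHom.id K) ?_
    ext x
    obtain ⟨a, rfl⟩ := e.surjective x
    simp
    rfl
  exact (isIntegral_algebraMap_iff hf).1 key3


/-- If `B₁, …, B_p` are rationals all of whose sums over nonempty index subsets are
nonzero, then `ℚ[y₁, …, y_p]` is a finitely generated module over the ℚ-subalgebra
generated by the weighted power sums `∑ i, B i • y iⁿ` for `n ≥ 1`; in particular
every variable `y i` is integral over that subalgebra. -/
theorem finite_over_weighted_power_sums (p : ℕ) (hp : 1 ≤ p) (B : Fin p → ℚ)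
    (hB : ∀ S : Finset (Fin p), S.Nonempty → ∑ i ∈ S, B i ≠ 0) :
    Module.Finite
      (Algebra.adjoin ℚ
        { q : MvPolynomial (Fin p) ℚ |
          ∃ n : ℕ, 1 ≤ n ∧ q = ∑ i : Fin p, C (B i) * X i ^ n })
      (MvPolynomial (Fin p) ℚ) ∧
    ∀ i : Fin p,
      IsIntegral
        (Algebra.adjoin ℚ
          { q : MvPolynomial (Fin p) ℚ |
            ∃ n : ℕ, 1 ≤ n ∧ q = ∑ i : Fin p, C (B i) * X i ^ n })
        (X i : MvPolynomial (Fin p) ℚ) := by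

  have hint := weighted_aux_integral p B hB
    (Algebra.adjoin ℚ
        { q : MvPolynomial (Fin p) ℚ |
          ∃ n : ℕ, 1 ≤ n ∧ q = ∑ i : Fin p, C (B i) * X i ^ n })
    (fun n hn => Algebra.subset_adjoin ⟨n, hn, rfl⟩)
  refine ⟨?_, hint⟩
  generalize (Algebra.adjoin ℚ
        { q : MvPolynomial (Fin p) ℚ |
          ∃ n : ℕ, 1 ≤ n ∧ q = ∑ i : Fin p, C (B i) * X i ^ n }) = A at hint
  have : Algebra.IsIntegral A (MvPolynomial (Fin p) ℚ) := by
    refine ⟨fun x => ?_⟩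
    induction x using MvPolynomial.induction_on with
    | C a => exact isIntegral_algebraMap (x := (algebraMap ℚ A a))
    | add p q hp hq => exact hp.add hq
    | mul_X p i h => exact h.mul (hint i)
  have : Algebra.FiniteType A (MvPolynomial (Fin p) ℚ) :=
    Algebra.FiniteType.of_restrictScalars_finiteType ℚ _ _
  exact Algebra.IsIntegral.finite
end

section
/- Let G be a set of homogeneous polynomials of positive degree in ℚ[y₁, …, y_p], and let B be the ℚ-subalgebra of ℚ[y₁, …, y_p] generated by G. If the radical of the ideal generated by G equals the maximal homogeneous ideal (y₁, …, y_p), then ℚ[y₁, …, y_p] is a finitely generated B-module. -/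
open MvPolynomial

set_option synthInstance.maxHeartbeats 1000000
set_option maxHeartbeats 1000000

/-- If `G` is a set of homogeneous polynomials of positive degree in `ℚ[y₁, …, y_p]`
whose generated ideal has radical equal to the maximal homogeneous ideal
`(y₁, …, y_p)`, then `ℚ[y₁, …, y_p]` is a finitely generated module over the
ℚ-subalgebra generated by `G`. -/
theorem finite_over_adjoin_of_radical_eq_irrelevant (p : ℕ)
    (G : Set (MvPolynomial (Fin p) ℚ))
    (hG : ∀ g ∈ G, ∃ d : ℕ, 0 < d ∧ g.IsHomogeneous d)
    (hrad : (Ideal.span G).radical =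
      Ideal.span (Set.range (X : Fin p → MvPolynomial (Fin p) ℚ))) :
    Module.Finite (Algebra.adjoin ℚ G) (MvPolynomial (Fin p) ℚ) := by
  obtain ⟨N, hN⟩ : ∃ N, idealOfVars (Fin p) ℚ ^ N ≤ Ideal.span G :=
    Ideal.exists_pow_le_of_le_radical_of_fg (le_of_eq hrad.symm) (IsNoetherian.noetherian _)
  set S : Set (MvPolynomial (Fin p) ℚ) :=
    (fun s : Fin p →₀ ℕ => monomial s (1 : ℚ)) '' {s | s.degree ≤ N} with hS
  have hSfin : S.Finite := (Finsupp.finite_of_degree_le N).image _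
  set M : Submodule (Algebra.adjoin ℚ G) (MvPolynomial (Fin p) ℚ) :=
    Submodule.span _ S with hM
  have key : ∀ n : ℕ, ∀ h : MvPolynomial (Fin p) ℚ, homogeneousComponent n h ∈ M := by
    intro n
    induction n using Nat.strong_induction_on with
    | _ n ih =>
    intro h
    by_cases hn : n ≤ N
    · rw [homogeneousComponent_apply]
      refine Submodule.sum_mem _ fun d hd => ?_
      have hd' : d.degree = n := (Finset.mem_filter.mp hd).2
      have h1 : monomial d (1 : ℚ) ∈ M :=
        Submodule.subset_span ⟨d, by simpa [hd'] using hn, rfl⟩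
      have h2 := M.smul_mem (algebraMap ℚ (Algebra.adjoin ℚ G) (coeff d h)) h1
      rw [algebraMap_smul, smul_monomial, smul_eq_mul, mul_one] at h2
      exact h2
    · have hmem : homogeneousComponent n h ∈ Ideal.span G := by
        apply hN
        rw [mem_pow_idealOfVars_iff']
        intro x hx
        rw [coeff_homogeneousComponent, if_neg]
        omega
      have aux : ∀ f ∈ Ideal.span G, ∀ a, homogeneousComponent n (a * f) ∈ M := by
        intro f hf
        induction hf using Submodule.span_induction with
        | mem g hg =>
          intro a
          obtain ⟨d, hd, hgd⟩ := hG g hg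
          rw [← sum_homogeneousComponent a, Finset.sum_mul, map_sum]
          refine Submodule.sum_mem _ fun i _ => ?_
          rw [homogeneousComponent_of_mem
            ((homogeneousComponent_isHomogeneous i a).mul hgd)]
          split_ifs with hi
          · have h2 := M.smul_mem (⟨g, Algebra.subset_adjoin hg⟩ : Algebra.adjoin ℚ G)
              (ih i (by omega) a)
            rw [mul_comm]
            exact h2
          · exact M.zero_mem
        | zero => intro a; simp
        | add x y _ _ hx hy =>
          intro a
          rw [mul_add, map_add]
          exact M.add_mem (hx a) (hy a)
        | smul r x _ hx =>
          intro a
          rw [smul_eq_mul, ← mul_assoc]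
          exact hx _
      have := aux _ hmem 1
      rwa [one_mul, homogeneousComponent_eq_self (homogeneousComponent_isHomogeneous n h)]
        at this
  refine ⟨⟨hSfin.toFinset, ?_⟩⟩
  rw [Set.Finite.coe_toFinset, eq_top_iff]
  intro f _
  rw [← sum_homogeneousComponent f]
  exact Submodule.sum_mem _ fun i _ => key i f
end

section
/- Let A be a commutative ring, let k ≥ 1, and let M be a k × k matrix over A. Then ∑_{σ ∈ Σ_{k+1}} sign(σ) · (∏_{O} tr(M^{|O|})) · M^{|O₀(σ)| − 1} = 0 in the ring of k × k matrices over A, where the sum runs over all permutations σ of the set {0, 1, …, k}, the product runs over all orbits O of σ on {0, 1, …, k} not containing the element 0 (fixed points counting as orbits of size 1), |O| denotes the cardinality of the orbit O, and O₀(σ) denotes the orbit of σ containing 0. -/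
open scoped Classical

/-- The size of the orbit (cycle) of `i` under the permutation `σ`; fixed points
have orbits of size 1. -/
noncomputable def orbitSize {n : ℕ} (σ : Equiv.Perm (Fin n)) (i : Fin n) : ℕ :=
  Set.ncard { j | σ.SameCycle i j }

/-- Weighted sum over paths of length `m`. -/
lemma path_sum {A : Type*} [CommRing A] {k : ℕ} (M : Matrix (Fin k) (Fin k) A) (m : ℕ)
    (F : Fin k → Fin k → A) :
    ∑ g : Fin (m + 1) → Fin k,
      (∏ i : Fin m, M (g i.castSucc) (g i.succ)) * F (g (Fin.last m)) (g 0)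
      = ∑ a, ∑ b, (M ^ m) a b * F b a := by
  induction m generalizing F with
  | zero =>
    rw [← (Equiv.funUnique (Fin 1) (Fin k)).symm.sum_comp]
    simp [Matrix.one_apply]
  | succ m ih =>
    rw [← (Fin.consEquiv (fun _ : Fin (m + 2) => Fin k)).sum_comp, Fintype.sum_prod_type]
    refine Finset.sum_congr rfl fun a _ => ?_
    have h := ih (fun d c => M a c * F d a)
    have h2 : ∀ g : Fin (m + 1) → Fin k,
        (∏ i : Fin (m + 1), M ((Fin.consEquiv (fun _ : Fin (m + 2) => Fin k)) (a, g) i.castSucc)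
          ((Fin.consEquiv (fun _ : Fin (m + 2) => Fin k)) (a, g) i.succ))
          * F ((Fin.consEquiv (fun _ : Fin (m + 2) => Fin k)) (a, g) (Fin.last (m + 1)))
            ((Fin.consEquiv (fun _ : Fin (m + 2) => Fin k)) (a, g) 0)
        = (∏ i : Fin m, M (g i.castSucc) (g i.succ)) * (M a (g 0) * F (g (Fin.last m)) a) := by
      intro g
      rw [Fin.prod_univ_succ]
      simp only [Fin.consEquiv_apply, Fin.castSucc_zero, Fin.cons_zero, Fin.cons_succ,
        ← Fin.succ_castSucc, ← Fin.succ_last]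
      ring
    rw [Finset.sum_congr rfl fun g _ => h2 g, h, Finset.sum_comm]
    refine Finset.sum_congr rfl fun b _ => ?_
    rw [pow_succ', Matrix.mul_apply, Finset.sum_mul]
    exact Finset.sum_congr rfl fun c _ => by ring

/-- An orbit is enumerated by iterating, ending at the base point. -/
lemma orbit_enum {n : ℕ} (σ : Equiv.Perm (Fin n)) (j : Fin n) (P : Fin n → Prop) [DecidablePred P]
    (hP : ∀ x, P x ↔ σ.SameCycle j x) :
    ∃ m : ℕ, orbitSize σ j = m + 1 ∧ ∃ e : Fin (m + 1) ≃ {x // P x},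
      (e (Fin.last m) : Fin n) = j ∧ σ j = e 0 ∧
      ∀ i : Fin m, σ (e i.castSucc) = e i.succ := by
  have hper : j ∈ Function.periodicPts σ := by
    refine Function.mk_mem_periodicPts (orderOf_pos σ) ?_
    rw [Function.IsPeriodicPt, Function.IsFixedPt, Equiv.Perm.iterate_eq_pow, pow_orderOf_eq_one]
    rfl
  have hpos := Function.minimalPeriod_pos_of_mem_periodicPts hper
  obtain ⟨m, hm⟩ : ∃ m, Function.minimalPeriod σ j = m + 1 := ⟨_, (Nat.succ_pred_eq_of_pos hpos).symm⟩
  have hfix : σ^[m + 1] j = j := by rw [← hm]; exact Function.iterate_minimalPeriod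
  let e0 : Fin (m + 1) → {x // P x} := fun i => ⟨σ^[i + 1] j, (hP _).2
    ⟨((i + 1 : ℕ) : ℤ), by rw [zpow_natCast, Equiv.Perm.iterate_eq_pow]⟩⟩
  have hinj : Function.Injective e0 := by
    intro a b hab
    have h1 : σ^[a + 1] j = σ^[b + 1] j := congrArg Subtype.val hab
    rw [Function.iterate_succ_apply', Function.iterate_succ_apply'] at h1
    have h2 := σ.injective h1
    have := Function.iterate_injOn_Iio_minimalPeriod (f := σ) (x := j)
      (by rw [hm]; exact a.2) (by rw [hm]; exact b.2) h2
    exact Fin.ext this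
  have hsurj : Function.Surjective e0 := by
    rintro ⟨x, hx⟩
    have hs := ((hP x).1 hx)
    have hs2 : σ.SameCycle j (σ⁻¹ x) := by
      refine Equiv.Perm.sameCycle_apply_right.1 ?_
      simpa using hs
    obtain ⟨i, hi⟩ := hs2.exists_nat_pow_eq
    refine ⟨⟨i % (m + 1), Nat.mod_lt _ (Nat.succ_pos _)⟩, Subtype.ext ?_⟩
    change σ^[i % (m + 1) + 1] j = x
    rw [Function.iterate_succ_apply', ← hm, Function.iterate_mod_minimalPeriod_eq,
      Equiv.Perm.iterate_eq_pow, hi]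
    simp
  let e := Equiv.ofBijective e0 ⟨hinj, hsurj⟩
  refine ⟨m, ?_, e, ?_, ?_, ?_⟩
  · have : { x | σ.SameCycle j x } = { x | P x } := by ext x; simp [hP]
    rw [orbitSize, this, ← Nat.card_coe_set_eq]
    have := Nat.card_congr e
    rw [Nat.card_fin] at this
    exact this.symm
  · exact hfix
  · rfl
  · intro i
    change σ (σ^[i + 1] j) = σ^[(i + 1) + 1] j
    rw [← Function.iterate_succ_apply' σ]

/-- The sum over colourings of a single orbit. -/
lemma orbit_sum {A : Type*} [CommRing A] {k n : ℕ} (M : Matrix (Fin k) (Fin k) A)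
    (N : Fin n → Matrix (Fin k) (Fin k) A)
    (σ : Equiv.Perm (Fin n)) (j : Fin n) (P : Fin n → Prop) [DecidablePred P]
    (hP : ∀ x, P x ↔ σ.SameCycle j x) (hσ : ∀ x, P x → P (σ x))
    (hN : ∀ x, P x → x ≠ j → N x = M) :
    ∑ g : {x // P x} → Fin k, ∏ x : {x // P x}, N x (g x) (g ⟨σ x, hσ x x.2⟩)
      = ∑ a, ∑ b, (M ^ (orbitSize σ j - 1)) a b * N j b a := by
  obtain ⟨m, hm, e, h1, h2, h3⟩ := orbit_enum σ j P hP
  rw [hm, Nat.add_sub_cancel, ← path_sum M m (N j),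
    ← (Equiv.arrowCongr e (Equiv.refl (Fin k))).sum_comp]
  refine Finset.sum_congr rfl fun g _ => ?_
  rw [← e.prod_comp, Fin.prod_univ_castSucc]
  congr 1
  · refine Finset.prod_congr rfl fun i _ => ?_
    have ha : (⟨σ (e i.castSucc), hσ _ (e i.castSucc).2⟩ : {x // P x}) = e i.succ :=
      Subtype.ext (h3 i)
    have hb : (e i.castSucc : Fin n) ≠ j := by
      rw [← h1]
      intro h
      exact (Fin.castSucc_lt_last i).ne (e.injective (Subtype.ext h))
    rw [ha, hN _ (e i.castSucc).2 hb]
    simp [Equiv.arrowCongr]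
  · have ha : (⟨σ (e (Fin.last m)), hσ _ (e (Fin.last m)).2⟩ : {x // P x}) = e 0 :=
      Subtype.ext ((congrArg σ h1).trans h2)
    rw [ha, h1]
    simp [Equiv.arrowCongr]

/-- Factorisation of a sum over colourings along the fibres of an invariant map. -/
lemma fiber_factor {A : Type*} [CommRing A] {k n : ℕ}
    (N : Fin n → Matrix (Fin k) (Fin k) A)
    (σ : Equiv.Perm (Fin n)) (r : Fin n → Fin n) (hr : ∀ x, r (σ x) = r x) :
    ∑ f : Fin n → Fin k, ∏ x, N x (f x) (f (σ x))
      = ∏ j, ∑ g : {x // r x = j} → Fin k, ∏ x : {x // r x = j},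
          N x (g x) (g ⟨σ x, (hr x).trans x.2⟩) := by
  rw [Finset.prod_univ_sum, Fintype.piFinset_univ]
  let E : (Fin n → Fin k) ≃ (∀ j, {x // r x = j} → Fin k) :=
    { toFun := fun f j x => f x
      invFun := fun p x => p (r x) ⟨x, rfl⟩
      left_inv := fun f => rfl
      right_inv := fun p => by
        funext j x
        obtain ⟨x, rfl⟩ := x
        rfl }
  rw [← E.sum_comp]
  refine Finset.sum_congr rfl fun f _ => ?_
  exact (Fintype.prod_fiberwise r (fun x => N x (f x) (f (σ x)))).symm

lemma term_entry {A : Type*} [CommRing A] {k n : ℕ} (M : Matrix (Fin k) (Fin k) A)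
    (σ : Equiv.Perm (Fin (n + 1))) (a b : Fin k) :
    ∑ f : Fin (n + 1) → Fin k,
      ∏ x, (if x = 0 then Matrix.single b a (1 : A) else M) (f x) (f (σ x))
      = (∏ j ∈ Finset.univ.filter (fun j : Fin (n + 1) =>
              (∀ m, σ.SameCycle j m → j ≤ m) ∧ ¬ σ.SameCycle 0 j),
            (M ^ orbitSize σ j).trace) * (M ^ (orbitSize σ 0 - 1)) a b := by
  have hex : ∀ x : Fin (n + 1), ∃ y, σ.SameCycle x y ∧ ∀ m, σ.SameCycle x m → y ≤ m := by
    intro x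
    obtain ⟨y, hy, hmin⟩ := Finset.exists_min_image
      (Finset.univ.filter fun y => σ.SameCycle x y) id ⟨x, by simp [Equiv.Perm.SameCycle.refl]⟩
    exact ⟨y, by simpa using hy, fun m hm => hmin m (by simpa using hm)⟩
  choose r hr1 hr2 using hex
  have hrs : ∀ x y, σ.SameCycle x y → r x = r y := fun x y h =>
    le_antisymm (hr2 x _ (h.trans (hr1 y))) (hr2 y _ (h.symm.trans (hr1 x)))
  have hrσ : ∀ x, r (σ x) = r x := fun x =>
    (hrs _ _ (Equiv.Perm.sameCycle_apply_right.2 (Equiv.Perm.SameCycle.refl σ x))).symm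
  have hself : ∀ j, (∀ m, σ.SameCycle j m → j ≤ m) → r j = j := fun j h =>
    le_antisymm (hr2 j j (Equiv.Perm.SameCycle.refl σ j)) (h _ (hr1 j))
  have hP : ∀ j, r j = j → ∀ x, r x = j ↔ σ.SameCycle j x := fun j hj x =>
    ⟨fun h => by have := hr1 x; rw [h] at this; exact this.symm,
      fun h => by rw [← hrs _ _ h, hj]⟩
  have hr0 : r 0 = 0 := hself 0 fun m _ => Fin.zero_le m
  rw [fiber_factor (fun x => if x = 0 then Matrix.single b a (1 : A) else M) σ r hrσ]
  rw [← Finset.mul_prod_erase _ _ (Finset.mem_univ (0 : Fin (n + 1))), mul_comm]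
  congr 1
  · rw [← Finset.prod_subset (s₂ := Finset.univ.erase 0) (s₁ := Finset.univ.filter (fun j : Fin (n + 1) =>
              (∀ m, σ.SameCycle j m → j ≤ m) ∧ ¬ σ.SameCycle 0 j))]
    · refine Finset.prod_congr rfl fun j hj => ?_
      simp only [Finset.mem_filter, Finset.mem_univ, true_and] at hj
      have hjr := hself j hj.1
      have hj0 : j ≠ 0 := by rintro rfl; exact hj.2 (Equiv.Perm.SameCycle.refl σ 0)
      refine (orbit_sum M (fun x => if x = 0 then Matrix.single b a (1 : A) else M) σ j (fun x => r x = j) (hP j hjr) (fun x h => (hrσ x).trans h) ?_).trans ?_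
      rotate_left
      · obtain ⟨m, hm, -⟩ := orbit_enum σ j _ (hP j hjr)
        simp only [if_neg hj0]
        rw [hm, Nat.add_sub_cancel, pow_succ, Matrix.trace]
        simp [Matrix.mul_apply]
      · intro x hx _
        refine if_neg ?_
        rintro rfl
        exact hj0 (hx.symm.trans hr0)
    · intro j hj
      simp only [Finset.mem_filter, Finset.mem_univ, true_and] at hj
      simp only [Finset.mem_erase, Finset.mem_univ, and_true]
      rintro rfl; exact hj.2 (Equiv.Perm.SameCycle.refl σ 0)
    · intro j hj hj'
      simp only [Finset.mem_erase, Finset.mem_univ, and_true] at hj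
      have : IsEmpty {x // r x = j} := by
        refine ⟨fun ⟨x, hx⟩ => hj' ?_⟩
        simp only [Finset.mem_filter, Finset.mem_univ, true_and]
        have hx1 := hr1 x
        rw [hx] at hx1
        refine ⟨fun m hm => ?_, fun h => ?_⟩
        · rw [← hx]; exact hr2 x m (hx1.trans hm)
        · have := hrs _ _ (h.trans hx1.symm)
          rw [hr0, hx] at this
          exact hj this.symm
      simp
  · refine (orbit_sum M (fun x => if x = 0 then Matrix.single b a (1 : A) else M) σ 0 (fun x => r x = 0) (hP 0 hr0) (fun x h => (hrσ x).trans h) ?_).trans ?_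
    rotate_left
    · simp only [if_true]
      rw [Finset.sum_eq_single a, Finset.sum_eq_single b]
      · simp
      · intro c _ hc; simp [Matrix.single_apply, hc.symm]
      · simp
      · intro c _ hc; simp [Matrix.single_apply, hc.symm]
      · simp
    · intro x _ hx
      exact if_neg hx

/-- The fundamental trace identity (a trace form of the Cayley–Hamilton theorem):
for a `k × k` matrix `M` over a commutative ring,
`∑_{σ ∈ Σ_{k+1}} sign(σ) · (∏_{O} tr(M^{|O|})) · M^{|O₀(σ)|−1} = 0`, the product
running over the orbits of `σ` on `{0, …, k}` not containing `0` (represented below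
by their minimal elements), and `O₀(σ)` being the orbit containing `0`. -/
theorem trace_identity {A : Type*} [CommRing A] (k : ℕ) (hk : 1 ≤ k)
    (M : Matrix (Fin k) (Fin k) A) :
    ∑ σ : Equiv.Perm (Fin (k + 1)),
      (Equiv.Perm.sign σ : ℤ) •
        ((∏ j ∈ Finset.univ.filter (fun j : Fin (k + 1) =>
              (∀ m, σ.SameCycle j m → j ≤ m) ∧ ¬ σ.SameCycle 0 j),
            (M ^ orbitSize σ j).trace) •
          M ^ (orbitSize σ 0 - 1)) = 0 := by
  ext a b
  simp only [Matrix.sum_apply, Matrix.smul_apply, Matrix.zero_apply, smul_eq_mul]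
  simp only [← term_entry, Finset.smul_sum]
  rw [Finset.sum_comm]
  refine Finset.sum_eq_zero fun f _ => ?_
  obtain ⟨x, y, hxy, hf⟩ := Fintype.exists_ne_map_eq_of_card_lt f (by simp)
  have hdet : Matrix.det (Matrix.of fun y x : Fin (k + 1) =>
      (if x = 0 then Matrix.single b a (1 : A) else M) (f x) (f y)) = 0 :=
    Matrix.det_zero_of_row_eq hxy (by funext z; simp [hf])
  rw [Matrix.det_apply] at hdet
  simpa [Units.smul_def] using hdet
end

section
/- In the quotient ring R := ℚ[x₁, x₂]/(x₂²), the ℚ-subalgebra generated by the elements x₁^{2i−1} · x₂ for i = 1, 2, 3, … is not finitely generated as a ℚ-algebra. -/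
open MvPolynomial

set_option synthInstance.maxHeartbeats 1000000
set_option maxHeartbeats 1000000

/-- Elements of a subalgebra whose generators map to dual numbers with constant first part and
second part in a subspace `W` have the same property. -/
theorem adjoin_dual_aux {R : Type*} [CommRing R] [Algebra ℚ R]
    (f : R →ₐ[ℚ] DualNumber (Polynomial ℚ)) (W : Submodule ℚ (Polynomial ℚ)) (s : Set R)
    (hs : ∀ x ∈ s, (∃ c : ℚ, (f x).fst = Polynomial.C c) ∧ (f x).snd ∈ W)
    (x : R) (hx : x ∈ Algebra.adjoin ℚ s) :
    (∃ c : ℚ, (f x).fst = Polynomial.C c) ∧ (f x).snd ∈ W := by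
  induction hx using Algebra.adjoin_induction with
  | mem x hx => exact hs x hx
  | algebraMap r =>
    rw [AlgHom.commutes]
    refine ⟨⟨r, ?_⟩, ?_⟩
    · rfl
    · have : (algebraMap ℚ (DualNumber (Polynomial ℚ)) r).snd = 0 := rfl
      rw [this]; exact W.zero_mem
  | add x y _ _ hx hy =>
    obtain ⟨⟨a, ha⟩, hx⟩ := hx
    obtain ⟨⟨b, hb⟩, hy⟩ := hy
    refine ⟨⟨a + b, ?_⟩, ?_⟩
    · rw [map_add, TrivSqZeroExt.fst_add, ha, hb, Polynomial.C_add]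
    · rw [map_add, TrivSqZeroExt.snd_add]; exact W.add_mem hx hy
  | mul x y _ _ hx hy =>
    obtain ⟨⟨a, ha⟩, hx⟩ := hx
    obtain ⟨⟨b, hb⟩, hy⟩ := hy
    refine ⟨⟨a * b, ?_⟩, ?_⟩
    · rw [map_mul, TrivSqZeroExt.fst_mul, ha, hb, Polynomial.C_mul]
    · rw [map_mul, DualNumber.snd_mul, ha, hb, mul_comm _ (Polynomial.C b),
        ← Polynomial.smul_eq_C_mul, ← Polynomial.smul_eq_C_mul]
      exact W.add_mem (W.smul_mem _ hy) (W.smul_mem _ hx)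

/-- The map `ℚ[x₁, x₂]/(x₂²) → ℚ[x][ε]`. -/
noncomputable def toDual : (MvPolynomial (Fin 2) ℚ ⧸
    Ideal.span {(X 1 : MvPolynomial (Fin 2) ℚ) ^ 2}) →ₐ[ℚ] DualNumber (Polynomial ℚ) :=
  Ideal.Quotient.liftₐ _
    (aeval ![TrivSqZeroExt.inl Polynomial.X, DualNumber.eps]) (by
      intro a ha
      obtain ⟨b, rfl⟩ := Ideal.mem_span_singleton.1 ha
      simp [pow_two])

theorem toDual_gen (n : ℕ) :
    toDual (Ideal.Quotient.mk (Ideal.span {(X 1 : MvPolynomial (Fin 2) ℚ) ^ 2})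
      (X 0 ^ n * X 1)) = TrivSqZeroExt.inr (Polynomial.X ^ n) := by
  have : toDual (Ideal.Quotient.mk (Ideal.span {(X 1 : MvPolynomial (Fin 2) ℚ) ^ 2})
      (X 0 ^ n * X 1)) = aeval ![TrivSqZeroExt.inl Polynomial.X, DualNumber.eps]
      (X 0 ^ n * X 1 : MvPolynomial (Fin 2) ℚ) := rfl
  rw [this]
  simp only [map_mul, map_pow, aeval_X, Matrix.cons_val_zero, Matrix.cons_val_one]
  ext <;> simp

/-- In `R = ℚ[x₁, x₂]/(x₂²)`, the ℚ-subalgebra generated by the images of the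
elements `x₁^(2i−1) · x₂`, `i ≥ 1`, is not finitely generated as a ℚ-algebra. -/
theorem not_fg_subalgebra_of_quotient :
    ¬ Subalgebra.FG (Algebra.adjoin ℚ
      { r : MvPolynomial (Fin 2) ℚ ⧸
            Ideal.span {(X 1 : MvPolynomial (Fin 2) ℚ) ^ 2} |
        ∃ i : ℕ, 1 ≤ i ∧
          r = Ideal.Quotient.mk (Ideal.span {(X 1 : MvPolynomial (Fin 2) ℚ) ^ 2})
                (X 0 ^ (2 * i - 1) * X 1) }) := by
  rintro ⟨t, ht⟩
  have h1 := adjoin_dual_aux toDual ⊤ _ (by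
    rintro x ⟨i, -, rfl⟩
    rw [toDual_gen]
    exact ⟨⟨0, by simp⟩, trivial⟩ : ∀ x ∈ { r : MvPolynomial (Fin 2) ℚ ⧸
            Ideal.span {(X 1 : MvPolynomial (Fin 2) ℚ) ^ 2} |
        ∃ i : ℕ, 1 ≤ i ∧
          r = Ideal.Quotient.mk (Ideal.span {(X 1 : MvPolynomial (Fin 2) ℚ) ^ 2})
                (X 0 ^ (2 * i - 1) * X 1) }, _)
  let N := t.sup fun g => (toDual g).snd.natDegree
  have h2 := adjoin_dual_aux toDual (Polynomial.degreeLE ℚ N) (t : Set _) (by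
    intro x hx
    refine ⟨(h1 x ?_).1, ?_⟩
    · rw [← ht]; exact Algebra.subset_adjoin hx
    · rw [Polynomial.mem_degreeLE]
      refine Polynomial.degree_le_natDegree.trans ?_
      exact_mod_cast Finset.le_sup (f := fun g => (toDual g).snd.natDegree) hx)
  rw [ht] at h2
  have h3 := (h2 _ (Algebra.subset_adjoin ⟨N + 1, by omega, rfl⟩)).2
  rw [toDual_gen, TrivSqZeroExt.snd_inr, Polynomial.mem_degreeLE, Polynomial.degree_X_pow] at h3
  have h4 : 2 * (N + 1) - 1 ≤ N := by exact_mod_cast h3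
  omega
end

section
/- Let φ : ℚ[a, b, c] → ℚ[x₁, x₂] be the ℚ-algebra homomorphism determined by φ(a) = 7x₁² − 7x₁x₂ + 7x₂², φ(b) = 4x₁² − 4x₁x₂ + 4x₂², and φ(c) = 23x₁⁶ − 69x₁⁵x₂ + 135x₁⁴x₂² − 155x₁³x₂³ + 135x₁²x₂⁴ − 69x₁x₂⁵ + 23x₂⁶. Then the kernel of φ is the principal ideal generated by 7b − 4a. -/
open MvPolynomial

/-- The quadratic form `x₁² − x₁x₂ + x₂²`. -/
noncomputable def qForm : MvPolynomial (Fin 2) ℚ := X 0 ^ 2 - X 0 * X 1 + X 1 ^ 2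

/-- The sextic form `x₁²x₂²(x₁ − x₂)²`. -/
noncomputable def dForm : MvPolynomial (Fin 2) ℚ := X 0 ^ 2 * X 1 ^ 2 * (X 0 - X 1) ^ 2

/-- Evaluation of a polynomial in two variables at `(qForm, dForm)`. -/
noncomputable def psi : Polynomial (Polynomial ℚ) →+* MvPolynomial (Fin 2) ℚ :=
  Polynomial.eval₂RingHom (Polynomial.aeval qForm : Polynomial ℚ →ₐ[ℚ] _).toRingHom dForm

/-- Restriction to `x₂ = 0`. -/
noncomputable def restr : MvPolynomial (Fin 2) ℚ →ₐ[ℚ] Polynomial ℚ :=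
  aeval ![Polynomial.X, 0]

lemma restr_q : restr qForm = Polynomial.X ^ 2 := by
  simp [restr, qForm]

lemma restr_d : restr dForm = 0 := by
  simp [restr, dForm]

lemma dForm_ne : dForm ≠ 0 := by
  intro h
  have := congrArg (MvPolynomial.eval ![(2 : ℚ), 1]) h
  simp [dForm] at this
  norm_num at this

lemma psi_X : psi Polynomial.X = dForm := by simp [psi]

lemma psi_C (p : Polynomial ℚ) : psi (Polynomial.C p) = Polynomial.aeval qForm p := by
  simp [psi]

lemma aeval_sq_eq_zero (p : Polynomial ℚ)
    (h : Polynomial.aeval (Polynomial.X ^ 2 : Polynomial ℚ) p = 0) : p = 0 := by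
  have h2 : Polynomial.expand ℚ 2 p = 0 := by
    rw [Polynomial.expand_eq_comp_X_pow, ← h, Polynomial.comp_eq_aeval]
  exact (Polynomial.expand_eq_zero (by norm_num)).1 h2

lemma psi_eq_zero (n : ℕ) : ∀ p : Polynomial (Polynomial ℚ), p.natDegree < n →
    psi p = 0 → p = 0 := by
  induction n with
  | zero => intro p hp; omega
  | succ n ih =>
    intro p hp h
    have hdec := Polynomial.divX_mul_X_add p
    have h1 : psi p.divX * dForm + Polynomial.aeval qForm (p.coeff 0) = 0 := by
      rw [← psi_X, ← psi_C, ← map_mul, ← map_add, hdec, h]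
    have h2 : p.coeff 0 = 0 := by
      apply aeval_sq_eq_zero
      have := congrArg restr h1
      rwa [map_add, map_mul, restr_d, mul_zero, zero_add, map_zero,
        ← Polynomial.aeval_algHom_apply, restr_q] at this
    rw [h2, map_zero, add_zero] at h1
    have h3 : psi p.divX = 0 := (mul_eq_zero.1 h1).resolve_right dForm_ne
    rw [h2, map_zero, add_zero] at hdec
    by_cases hd : p.natDegree = 0
    · rw [Polynomial.eq_C_of_natDegree_eq_zero hd, h2, map_zero]
    · have h4 : p.divX = 0 := ih _ (by rw [Polynomial.natDegree_divX_eq_natDegree_tsub_one]; omega) h3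
      rw [← hdec, h4, zero_mul]

/-- The map `ℚ[a,b,c] → ℚ[q,d]` through which the localisation map factors. -/
noncomputable def theta : MvPolynomial (Fin 3) ℚ →ₐ[ℚ] Polynomial (Polynomial ℚ) :=
  aeval ![7 * Polynomial.C Polynomial.X, 4 * Polynomial.C Polynomial.X,
    23 * Polynomial.C Polynomial.X ^ 3 - 3 * Polynomial.X]

/-- A section of `theta`. -/
noncomputable def sigma : Polynomial (Polynomial ℚ) →+* MvPolynomial (Fin 3) ℚ :=
  Polynomial.eval₂RingHom
    (Polynomial.aeval (C 7⁻¹ * X 0 : MvPolynomial (Fin 3) ℚ) : Polynomial ℚ →ₐ[ℚ] _).toRingHom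
    (C 3⁻¹ * (23 * (C 7⁻¹ * X 0) ^ 3 - X 2))

lemma sigma_X : sigma Polynomial.X = C 3⁻¹ * (23 * (C 7⁻¹ * X 0) ^ 3 - X 2) := by
  simp [sigma]

lemma sigma_CX : sigma (Polynomial.C Polynomial.X) = C 7⁻¹ * X 0 := by
  simp [sigma]

lemma ringHom_ext_rat {S : Type*} [CommRing S] (f g : MvPolynomial (Fin 3) ℚ →+* S)
    (h : ∀ i, f (X i) = g (X i)) : f = g := by
  apply MvPolynomial.ringHom_ext _ h
  intro r
  exact RingHom.congr_fun (Subsingleton.elim (f.comp C) (g.comp C)) r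

lemma C_seven : (7 * C 7⁻¹ : MvPolynomial (Fin 3) ℚ) = 1 := by
  rw [show (7 : MvPolynomial (Fin 3) ℚ) = C 7 from (map_ofNat C 7).symm, ← C_mul]; norm_num

lemma C_three : (3 * C 3⁻¹ : MvPolynomial (Fin 3) ℚ) = 1 := by
  rw [show (3 : MvPolynomial (Fin 3) ℚ) = C 3 from (map_ofNat C 3).symm, ← C_mul]; norm_num

lemma mk_sigma_theta :
    (Ideal.Quotient.mk (Ideal.span {(7 * X 1 - 4 * X 0 : MvPolynomial (Fin 3) ℚ)})).comp
      (sigma.comp theta.toRingHom) =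
    Ideal.Quotient.mk (Ideal.span {(7 * X 1 - 4 * X 0 : MvPolynomial (Fin 3) ℚ)}) := by
  apply ringHom_ext_rat
  · intro i
    simp only [RingHom.comp_apply]
    rw [Ideal.Quotient.mk_eq_mk_iff_sub_mem, Ideal.mem_span_singleton]
    fin_cases i
    · simp [theta, map_ofNat, sigma_X, sigma_CX]
      refine ⟨0, ?_⟩
      linear_combination X 0 * C_seven
    · simp [theta, map_ofNat, sigma_X, sigma_CX]
      refine ⟨- C 7⁻¹, ?_⟩
      linear_combination X 1 * C_seven
    · simp [theta, map_ofNat, sigma_X, sigma_CX]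
      refine ⟨0, ?_⟩
      linear_combination (X 2 - 23 * (C 7⁻¹ * X 0) ^ 3) * C_three

/-- The ℚ-algebra map `φ : ℚ[a,b,c] → ℚ[x₁,x₂]` sending
`a ↦ 7x₁² − 7x₁x₂ + 7x₂²`, `b ↦ 4x₁² − 4x₁x₂ + 4x₂²`, and
`c ↦ 23x₁⁶ − 69x₁⁵x₂ + 135x₁⁴x₂² − 155x₁³x₂³ + 135x₁²x₂⁴ − 69x₁x₂⁵ + 23x₂⁶`
has kernel the principal ideal generated by `7b − 4a`. -/
theorem ker_localisation_CP2 :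
    RingHom.ker (MvPolynomial.aeval
      (R := ℚ)
      (![7 * X 0 ^ 2 - 7 * X 0 * X 1 + 7 * X 1 ^ 2,
         4 * X 0 ^ 2 - 4 * X 0 * X 1 + 4 * X 1 ^ 2,
         23 * X 0 ^ 6 - 69 * X 0 ^ 5 * X 1 + 135 * X 0 ^ 4 * X 1 ^ 2
           - 155 * X 0 ^ 3 * X 1 ^ 3 + 135 * X 0 ^ 2 * X 1 ^ 4
           - 69 * X 0 * X 1 ^ 5 + 23 * X 1 ^ 6] :
        Fin 3 → MvPolynomial (Fin 2) ℚ)) =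
    Ideal.span {(7 * X 1 - 4 * X 0 : MvPolynomial (Fin 3) ℚ)} := by
  apply le_antisymm
  · intro p hp
    rw [RingHom.mem_ker] at hp
    have key : psi (theta p) = 0 := by
      rw [← hp]
      refine RingHom.congr_fun (ringHom_ext_rat (psi.comp theta.toRingHom) (AlgHom.toRingHom (aeval _)) ?_) p
      intro i
      fin_cases i
      · simp [theta, map_ofNat, psi_X, psi_C, qForm, dForm]; ring
      · simp [theta, map_ofNat, psi_X, psi_C, qForm, dForm]; ring
      · simp [theta, map_ofNat, psi_X, psi_C, qForm, dForm]; ring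
    have h0 : theta p = 0 := psi_eq_zero _ _ (Nat.lt_succ_self _) key
    have h1 := RingHom.congr_fun mk_sigma_theta p
    rw [← Ideal.Quotient.eq_zero_iff_mem, ← h1]
    simp [h0]
  · rw [Ideal.span_singleton_le_iff_mem, RingHom.mem_ker]
    simp only [map_sub, map_mul, map_ofNat, aeval_X, Matrix.cons_val_zero, Matrix.cons_val_one]
    ring
end

section
/- In the polynomial ring ℚ[a, b, c], let I be the ideal generated by the four polynomials (4a − 7b)(a − 2b)c, (4a − 7b)(a − 2b)(21b + 8a), (4a − 7b)(316b³ − 343c), and (4a − 7b)(1264ab² + 2212b³ − 5145c). Then I is not a radical ideal, and the radical of I equals the ideal generated by the two polynomials (4a − 7b)(a − 2b) and (4a − 7b)(316b³ − 343c). -/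
open MvPolynomial

/-- If an algebra endomorphism `e` fixes all variables modulo `K`, it is the identity modulo `K`. -/
lemma sub_aeval_mem (K : Ideal (MvPolynomial (Fin 3) ℚ)) (v : Fin 3 → MvPolynomial (Fin 3) ℚ)
    (h : ∀ i, X i - v i ∈ K) (f : MvPolynomial (Fin 3) ℚ) : f - aeval v f ∈ K := by
  have key : (Ideal.Quotient.mkₐ ℚ K) = (Ideal.Quotient.mkₐ ℚ K).comp (aeval v) := by
    apply MvPolynomial.algHom_ext
    intro i
    simpa using (Ideal.Quotient.eq.2 (h i))
  apply Ideal.Quotient.eq.1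
  exact DFunLike.congr_fun key f

lemma C_four_seven : (C (7/4 : ℚ) : MvPolynomial (Fin 3) ℚ) * 4 = 7 := by
  rw [show (4 : MvPolynomial (Fin 3) ℚ) = C 4 from (map_ofNat C 4).symm,
    show (7 : MvPolynomial (Fin 3) ℚ) = C 7 from (map_ofNat C 7).symm, ← C_mul]
  norm_num

lemma C_quarter : (C (1/4 : ℚ) : MvPolynomial (Fin 3) ℚ) * 4 = 1 := by
  rw [show (4 : MvPolynomial (Fin 3) ℚ) = C 4 from (map_ofNat C 4).symm, ← C_mul]
  norm_num

lemma C_343 : (C (1/343 : ℚ) : MvPolynomial (Fin 3) ℚ) * 343 = 1 := by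
  rw [show (343 : MvPolynomial (Fin 3) ℚ) = C 343 from (map_ofNat C 343).symm, ← C_mul]
  norm_num

lemma C_1264 : (C (1/1264 : ℚ) : MvPolynomial (Fin 3) ℚ) * 1264 = 1 := by
  rw [show (1264 : MvPolynomial (Fin 3) ℚ) = C 1264 from (map_ofNat C 1264).symm, ← C_mul]
  norm_num

lemma C_16 : (C (1/16 : ℚ) : MvPolynomial (Fin 3) ℚ) * 16 = 1 := by
  rw [show (16 : MvPolynomial (Fin 3) ℚ) = C 16 from (map_ofNat C 16).symm, ← C_mul]
  norm_num

/-- The ideal on the right-hand side is radical. -/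
lemma J_isRadical : (Ideal.span
        ({(4 * X 0 - 7 * X 1) * (X 0 - 2 * X 1),
          (4 * X 0 - 7 * X 1) * (316 * X 1 ^ 3 - 343 * X 2)} :
          Set (MvPolynomial (Fin 3) ℚ))).IsRadical := by
  intro f hf
  obtain ⟨n, hn⟩ := hf
  obtain ⟨p, q, hpq⟩ := Ideal.mem_span_pair.1 hn
  -- first: the linear form divides `f`
  have h1 : aeval (![C (7/4) * X 1, X 1, X 2] : Fin 3 → MvPolynomial (Fin 3) ℚ) f = 0 := by
    have := congrArg (aeval (![C (7/4) * X 1, X 1, X 2] : Fin 3 → MvPolynomial (Fin 3) ℚ)) hpq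
    have hL : (4 : MvPolynomial (Fin 3) ℚ) * (C (7/4) * X 1) - 7 * X 1 = 0 := by
      linear_combination (X 1) * C_four_seven
    simp only [map_add, map_mul, map_sub, map_pow, aeval_X, map_ofNat, Matrix.cons_val] at this
    rw [hL] at this
    simp only [zero_mul, mul_zero, add_zero] at this
    exact eq_zero_of_pow_eq_zero this.symm
  have h2 := sub_aeval_mem (Ideal.span {4 * X 0 - 7 * X 1}) ![C (7/4) * X 1, X 1, X 2] (by
    intro i
    rw [Ideal.mem_span_singleton]
    fin_cases i
    · refine ⟨C (1/4), ?_⟩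
      have e : (C (7/4 : ℚ) : MvPolynomial (Fin 3) ℚ) = C (1/4) * 7 := by
        rw [show (7 : MvPolynomial (Fin 3) ℚ) = C 7 from (map_ofNat C 7).symm, ← C_mul]
        norm_num
      simp only [Fin.zero_eta, Matrix.cons_val]
      rw [e]
      linear_combination (-X 0) * C_quarter
    · simp
    · simp) f
  rw [h1, sub_zero, Ideal.mem_span_singleton] at h2
  obtain ⟨g, rfl⟩ := h2
  -- second: `g` vanishes on the curve
  have h3 : aeval (![2 * X 1, X 1, C (1/343) * 316 * X 1 ^ 3] :
      Fin 3 → MvPolynomial (Fin 3) ℚ) g = 0 := by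
    have := congrArg (aeval (![2 * X 1, X 1, C (1/343) * 316 * X 1 ^ 3] :
      Fin 3 → MvPolynomial (Fin 3) ℚ)) hpq
    have hP : (316 : MvPolynomial (Fin 3) ℚ) * X 1 ^ 3 - 343 * (C (1/343) * 316 * X 1 ^ 3) = 0 := by
      linear_combination (-316 * X 1 ^ 3) * C_343
    have hL : (4 : MvPolynomial (Fin 3) ℚ) * (2 * X 1) - 7 * X 1 = X 1 := by ring
    simp only [map_add, map_mul, map_sub, map_pow, aeval_X, map_ofNat, Matrix.cons_val] at this
    rw [hP, hL] at this
    simp only [sub_self, mul_zero, add_zero] at this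
    have h := eq_zero_of_pow_eq_zero this.symm
    exact (mul_eq_zero.1 h).resolve_left (X_ne_zero 1)
  have h4 := sub_aeval_mem (Ideal.span {X 0 - 2 * X 1, 316 * X 1 ^ 3 - 343 * X 2})
    ![2 * X 1, X 1, C (1/343) * 316 * X 1 ^ 3] (by
    intro i
    rw [Ideal.mem_span_pair]
    fin_cases i
    · exact ⟨1, 0, by simp⟩
    · exact ⟨0, 0, by simp⟩
    · refine ⟨0, -C (1/343), ?_⟩
      simp only [Fin.reduceFinMk, Matrix.cons_val]
      linear_combination X 2 * C_343) g
  rw [h3, sub_zero, Ideal.mem_span_pair] at h4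
  obtain ⟨r, s, rfl⟩ := h4
  rw [Ideal.mem_span_pair]
  exact ⟨r, s, by ring⟩

/-- In `ℚ[a,b,c]` (with `a = X 0`, `b = X 1`, `c = X 2`), the ideal `I` generated by
`(4a−7b)(a−2b)c`, `(4a−7b)(a−2b)(21b+8a)`, `(4a−7b)(316b³−343c)` and
`(4a−7b)(1264ab²+2212b³−5145c)` is not radical, and its radical is generated by
`(4a−7b)(a−2b)` and `(4a−7b)(316b³−343c)`. -/
theorem radical_of_CP2_relation_ideal :
    (Ideal.span
        ({(4 * X 0 - 7 * X 1) * (X 0 - 2 * X 1) * X 2,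
          (4 * X 0 - 7 * X 1) * (X 0 - 2 * X 1) * (21 * X 1 + 8 * X 0),
          (4 * X 0 - 7 * X 1) * (316 * X 1 ^ 3 - 343 * X 2),
          (4 * X 0 - 7 * X 1) * (1264 * X 0 * X 1 ^ 2 + 2212 * X 1 ^ 3 - 5145 * X 2)} :
          Set (MvPolynomial (Fin 3) ℚ))).radical ≠
      Ideal.span
        ({(4 * X 0 - 7 * X 1) * (X 0 - 2 * X 1) * X 2,
          (4 * X 0 - 7 * X 1) * (X 0 - 2 * X 1) * (21 * X 1 + 8 * X 0),
          (4 * X 0 - 7 * X 1) * (316 * X 1 ^ 3 - 343 * X 2),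
          (4 * X 0 - 7 * X 1) * (1264 * X 0 * X 1 ^ 2 + 2212 * X 1 ^ 3 - 5145 * X 2)} :
          Set (MvPolynomial (Fin 3) ℚ)) ∧
    (Ideal.span
        ({(4 * X 0 - 7 * X 1) * (X 0 - 2 * X 1) * X 2,
          (4 * X 0 - 7 * X 1) * (X 0 - 2 * X 1) * (21 * X 1 + 8 * X 0),
          (4 * X 0 - 7 * X 1) * (316 * X 1 ^ 3 - 343 * X 2),
          (4 * X 0 - 7 * X 1) * (1264 * X 0 * X 1 ^ 2 + 2212 * X 1 ^ 3 - 5145 * X 2)} :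
          Set (MvPolynomial (Fin 3) ℚ))).radical =
      Ideal.span
        ({(4 * X 0 - 7 * X 1) * (X 0 - 2 * X 1),
          (4 * X 0 - 7 * X 1) * (316 * X 1 ^ 3 - 343 * X 2)} :
          Set (MvPolynomial (Fin 3) ℚ)) := by
  set I := (Ideal.span
        ({(4 * X 0 - 7 * X 1) * (X 0 - 2 * X 1) * X 2,
          (4 * X 0 - 7 * X 1) * (X 0 - 2 * X 1) * (21 * X 1 + 8 * X 0),
          (4 * X 0 - 7 * X 1) * (316 * X 1 ^ 3 - 343 * X 2),
          (4 * X 0 - 7 * X 1) * (1264 * X 0 * X 1 ^ 2 + 2212 * X 1 ^ 3 - 5145 * X 2)} :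
          Set (MvPolynomial (Fin 3) ℚ))) with hI
  have m2 : (4 * X 0 - 7 * X 1) * (X 0 - 2 * X 1) * (21 * X 1 + 8 * X 0) ∈ I :=
    Ideal.subset_span (by simp)
  have m3 : (4 * X 0 - 7 * X 1) * (316 * X 1 ^ 3 - 343 * X 2) ∈ I :=
    Ideal.subset_span (by simp)
  have m4 : (4 * X 0 - 7 * X 1) * (1264 * X 0 * X 1 ^ 2 + 2212 * X 1 ^ 3 - 5145 * X 2) ∈ I :=
    Ideal.subset_span (by simp)
  have m5 : (4 * X 0 - 7 * X 1) * (X 0 - 2 * X 1) * X 1 ^ 2 ∈ I := by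
    have h := I.mul_mem_left (C (1/1264)) (I.sub_mem m4 (I.mul_mem_left 15 m3))
    convert h using 1
    linear_combination (-((4 * X 0 - 7 * X 1) * (X 0 - 2 * X 1) * X 1 ^ 2)) * C_1264
  have msq : ((4 * X 0 - 7 * X 1) * (X 0 - 2 * X 1)) ^ 2 ∈ I := by
    -- `16 (4a-7b)(a-2b) = (8a+21b)(8a-51b) + 1295 b^2`
    have h := I.mul_mem_left (C (1/16)) (I.add_mem (I.mul_mem_left (8 * X 0 - 51 * X 1) m2)
      (I.mul_mem_left 1295 m5))
    convert h using 1
    linear_combination (-((4 * X 0 - 7 * X 1) * (X 0 - 2 * X 1)) ^ 2) * C_16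
  have hrad : (4 * X 0 - 7 * X 1) * (X 0 - 2 * X 1) ∈ I.radical := ⟨2, msq⟩
  refine ⟨?_, le_antisymm ?_ ?_⟩
  · intro h
    rw [h] at hrad
    -- restrict to the line `b = c = 0`
    have hle : I ≤ Ideal.comap (aeval (![Polynomial.X, 0, 0] : Fin 3 → Polynomial ℚ))
        (Ideal.span {Polynomial.X ^ 3}) := by
      rw [hI, Ideal.span_le]
      rintro x (rfl | rfl | rfl | rfl) <;>
        simp only [SetLike.mem_coe, Ideal.mem_comap, Ideal.mem_span_singleton, map_add, map_mul,
          map_sub, map_pow, aeval_X, map_ofNat, Matrix.cons_val]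
      · simp
      · exact ⟨32, by ring⟩
      · simp
      · simp
    have h5 := hle hrad
    simp only [Ideal.mem_comap, Ideal.mem_span_singleton, map_mul,
          map_sub, aeval_X, map_ofNat, Matrix.cons_val] at h5
    rw [Polynomial.X_pow_dvd_iff] at h5
    have h6 := h5 2 (by norm_num)
    rw [show (4 * Polynomial.X - 7 * 0) * (Polynomial.X - 2 * 0) =
      Polynomial.C (4 : ℚ) * Polynomial.X ^ 2 by
        rw [show Polynomial.C (4 : ℚ) = 4 from map_ofNat Polynomial.C 4]; ring] at h6
    simp at h6
  · refine J_isRadical.radical_le_iff.2 ?_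
    rw [hI, Ideal.span_le]
    rintro x (rfl | rfl | rfl | rfl) <;> rw [SetLike.mem_coe, Ideal.mem_span_pair]
    · exact ⟨X 2, 0, by ring⟩
    · exact ⟨21 * X 1 + 8 * X 0, 0, by ring⟩
    · exact ⟨0, 1, by ring⟩
    · exact ⟨1264 * X 1 ^ 2, 15, by ring⟩
  · rw [Ideal.span_le]
    rintro x (rfl | rfl)
    · exact hrad
    · exact Ideal.le_radical m3
end

section
/- In the polynomial ring ℚ[a, b, c], let K be the ideal generated by the seven polynomials c², ac, bc, 29a³ − 245c, 609b³ − 260c, 29ab² − 52c, and 87a²b − 77c. Then the quotient ring ℚ[a, b, c]/K is a finite-dimensional ℚ-vector space of dimension at most 7. -/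
open MvPolynomial

set_option synthInstance.maxHeartbeats 1000000
set_option maxHeartbeats 1000000

theorem span_eq_top_aux {A : Type*} [CommRing A] [Algebra ℚ A]
    (f : MvPolynomial (Fin 3) ℚ →ₐ[ℚ] A) (hf : Function.Surjective f) (a b c : A)
    (ha : f (X 0) = a) (hb : f (X 1) = b) (hc : f (X 2) = c)
    (h1 : c ^ 2 = 0) (h2 : a * c = 0) (h3 : b * c = 0)
    (h4 : a ^ 3 = (245 / 29 : ℚ) • c) (h5 : b ^ 3 = (260 / 609 : ℚ) • c)
    (h6 : a * b ^ 2 = (52 / 29 : ℚ) • c) (h7 : a ^ 2 * b = (77 / 87 : ℚ) • c) :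
    Submodule.span ℚ (Set.range ![1, a, b, a ^ 2, a * b, b ^ 2, c]) = ⊤ := by
  set S := Submodule.span ℚ (Set.range ![1, a, b, a ^ 2, a * b, b ^ 2, c]) with hS
  have m (i : Fin 7) : ![1, a, b, a ^ 2, a * b, b ^ 2, c] i ∈ S :=
    Submodule.subset_span ⟨i, rfl⟩
  have m0 : (1 : A) ∈ S := m 0
  have m1 : a ∈ S := m 1
  have m2 : b ∈ S := m 2
  have m3 : a ^ 2 ∈ S := m 3
  have m4 : a * b ∈ S := m 4
  have m5 : b ^ 2 ∈ S := m 5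
  have m6 : c ∈ S := m 6
  have key (y : A) (k0 : 1 * y ∈ S) (k1 : a * y ∈ S) (k2 : b * y ∈ S) (k3 : a ^ 2 * y ∈ S)
      (k4 : a * b * y ∈ S) (k5 : b ^ 2 * y ∈ S) (k6 : c * y ∈ S) :
      ∀ x ∈ S, x * y ∈ S := by
    intro x hx
    induction hx using Submodule.span_induction with
    | mem x h =>
      obtain ⟨i, rfl⟩ := h
      fin_cases i
      exacts [k0, k1, k2, k3, k4, k5, k6]
    | zero => simp
    | add x z _ _ h1 h2 => rw [add_mul]; exact S.add_mem h1 h2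
    | smul r x _ h => rw [smul_mul_assoc]; exact S.smul_mem r h
  have e (x y : A) (h : x = y) (hy : y ∈ S) : x ∈ S := h ▸ hy
  have z := S.zero_mem
  have ka := key a (e _ a (by ring) m1) (e _ (a ^ 2) (by ring) m3) (e _ (a * b) (by ring) m4)
    (e _ (a ^ 3) (by ring) (h4 ▸ S.smul_mem _ m6))
    (e _ (a ^ 2 * b) (by ring) (h7 ▸ S.smul_mem _ m6))
    (e _ (a * b ^ 2) (by ring) (h6 ▸ S.smul_mem _ m6))
    (e _ 0 (by rw [← h2]; ring) z)
  have kb := key b (e _ b (by ring) m2) (e _ (a * b) (by ring) m4) (e _ (b ^ 2) (by ring) m5)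
    (e _ (a ^ 2 * b) (by ring) (h7 ▸ S.smul_mem _ m6))
    (e _ (a * b ^ 2) (by ring) (h6 ▸ S.smul_mem _ m6))
    (e _ (b ^ 3) (by ring) (h5 ▸ S.smul_mem _ m6))
    (e _ 0 (by rw [← h3]; ring) z)
  have kc := key c (e _ c (by ring) m6) (e _ 0 h2 z) (e _ 0 h3 z)
    (e _ 0 (by linear_combination a * h2) z)
    (e _ 0 (by linear_combination a * h3) z)
    (e _ 0 (by linear_combination b * h3) z)
    (e _ 0 (by linear_combination h1) z)
  rw [eq_top_iff]
  rintro x -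
  obtain ⟨p, rfl⟩ := hf x
  induction p using MvPolynomial.induction_on with
  | C r =>
    have : f (C r) = r • (1 : A) := by
      rw [← Algebra.algebraMap_eq_smul_one]; exact f.commutes r
    rw [this]; exact S.smul_mem r m0
  | add p q hp hq => rw [map_add]; exact S.add_mem hp hq
  | mul_X p i hp =>
    rw [map_mul]
    fin_cases i
    · exact e _ _ (congrArg _ ha) (ka _ hp)
    · exact e _ _ (congrArg _ hb) (kb _ hp)
    · exact e _ _ (congrArg _ hc) (kc _ hp)

theorem smul_aux {A : Type*} [CommRing A] [Algebra ℚ A] (x c : A) (n m : ℚ) (hn : n ≠ 0)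
    (h : algebraMap ℚ A n * x - algebraMap ℚ A m * c = 0) : x = (m / n) • c := by
  rw [← Algebra.smul_def, ← Algebra.smul_def, sub_eq_zero] at h
  rw [div_eq_inv_mul, mul_smul, ← h, smul_smul, inv_mul_cancel₀ hn, one_smul]

/-- In `ℚ[a,b,c]` (with `a = X 0`, `b = X 1`, `c = X 2`), the quotient by the ideal
`K` generated by `c²`, `ac`, `bc`, `29a³−245c`, `609b³−260c`, `29ab²−52c` and
`87a²b−77c` is a finite-dimensional ℚ-vector space of dimension at most 7. -/
theorem CP2_disc_quotient_dim_le_seven :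
    Module.Finite ℚ
      (MvPolynomial (Fin 3) ℚ ⧸
        Ideal.span
          ({X 2 ^ 2, X 0 * X 2, X 1 * X 2,
            29 * X 0 ^ 3 - 245 * X 2,
            609 * X 1 ^ 3 - 260 * X 2,
            29 * X 0 * X 1 ^ 2 - 52 * X 2,
            87 * X 0 ^ 2 * X 1 - 77 * X 2} : Set (MvPolynomial (Fin 3) ℚ))) ∧
    Module.finrank ℚ
      (MvPolynomial (Fin 3) ℚ ⧸
        Ideal.span
          ({X 2 ^ 2, X 0 * X 2, X 1 * X 2,
            29 * X 0 ^ 3 - 245 * X 2,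
            609 * X 1 ^ 3 - 260 * X 2,
            29 * X 0 * X 1 ^ 2 - 52 * X 2,
            87 * X 0 ^ 2 * X 1 - 77 * X 2} : Set (MvPolynomial (Fin 3) ℚ))) ≤ 7 := by
  set I := Ideal.span
          ({X 2 ^ 2, X 0 * X 2, X 1 * X 2,
            29 * X 0 ^ 3 - 245 * X 2,
            609 * X 1 ^ 3 - 260 * X 2,
            29 * X 0 * X 1 ^ 2 - 52 * X 2,
            87 * X 0 ^ 2 * X 1 - 77 * X 2} : Set (MvPolynomial (Fin 3) ℚ)) with hI
  have q (p : MvPolynomial (Fin 3) ℚ) (hp : p ∈ ({X 2 ^ 2, X 0 * X 2, X 1 * X 2,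
            29 * X 0 ^ 3 - 245 * X 2,
            609 * X 1 ^ 3 - 260 * X 2,
            29 * X 0 * X 1 ^ 2 - 52 * X 2,
            87 * X 0 ^ 2 * X 1 - 77 * X 2} : Set (MvPolynomial (Fin 3) ℚ))) :
      Ideal.Quotient.mkₐ ℚ I p = 0 :=
    Ideal.Quotient.eq_zero_iff_mem.mpr (Ideal.subset_span hp)
  have r1 := q (X 2 ^ 2) (by simp)
  have r2 := q (X 0 * X 2) (by simp)
  have r3 := q (X 1 * X 2) (by simp)
  have r4 := q (29 * X 0 ^ 3 - 245 * X 2) (by simp)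
  have r5 := q (609 * X 1 ^ 3 - 260 * X 2) (by simp)
  have r6 := q (29 * X 0 * X 1 ^ 2 - 52 * X 2) (by simp)
  have r7 := q (87 * X 0 ^ 2 * X 1 - 77 * X 2) (by simp)
  simp only [map_mul, map_pow, map_sub, map_ofNat] at r1 r2 r3 r4 r5 r6 r7
  have top := span_eq_top_aux (Ideal.Quotient.mkₐ ℚ I) (Ideal.Quotient.mkₐ_surjective ℚ I)
    _ _ _ rfl rfl rfl r1 r2 r3
    (smul_aux _ _ 29 245 (by norm_num) (by simpa only [map_ofNat] using r4))
    (smul_aux _ _ 609 260 (by norm_num) (by simpa only [map_ofNat] using r5))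
    (smul_aux _ _ 29 52 (by norm_num) (by simpa only [map_ofNat, mul_assoc] using r6))
    (smul_aux _ _ 87 77 (by norm_num) (by simpa only [map_ofNat, mul_assoc] using r7))
  refine ⟨⟨Submodule.fg_def.mpr ⟨_, Set.finite_range _, top⟩⟩, ?_⟩
  rw [← finrank_top, ← top]
  exact (finrank_range_le_card _).trans (by simp)
end

section
/- In the polynomial ring ℚ[a, b, c], the quotient ring ℚ[a, b, c]/J, where J is the ideal generated by the two polynomials (4a − 7b)(a − 2b) and (4a − 7b)(316b³ − 343c), has Krull dimension 2. -/
open MvPolynomial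

/-- In `ℚ[a,b,c]` (with `a = X 0`, `b = X 1`, `c = X 2`), the quotient by the ideal
`J` generated by `(4a−7b)(a−2b)` and `(4a−7b)(316b³−343c)` has Krull dimension 2. -/
theorem CP2_tautological_variety_dim_two :
    ringKrullDim
      (MvPolynomial (Fin 3) ℚ ⧸
        Ideal.span
          ({(4 * X 0 - 7 * X 1) * (X 0 - 2 * X 1),
            (4 * X 0 - 7 * X 1) * (316 * X 1 ^ 3 - 343 * X 2)} :
            Set (MvPolynomial (Fin 3) ℚ))) = 2 := by
  apply le_antisymm
  · have hne : ((4 * X 0 - 7 * X 1) * (X 0 - 2 * X 1) : MvPolynomial (Fin 3) ℚ) ≠ 0 := by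
      intro h
      have h2 := congrArg (MvPolynomial.eval (![1, 0, 0] : Fin 3 → ℚ)) h
      simp at h2
    have key := ringKrullDim_succ_le_of_surjective
      (Ideal.Quotient.mk (Ideal.span
          ({(4 * X 0 - 7 * X 1) * (X 0 - 2 * X 1),
            (4 * X 0 - 7 * X 1) * (316 * X 1 ^ 3 - 343 * X 2)} :
            Set (MvPolynomial (Fin 3) ℚ)))) Ideal.Quotient.mk_surjective
      (mem_nonZeroDivisors_of_ne_zero hne)
      (Ideal.Quotient.eq_zero_iff_mem.mpr (Ideal.subset_span (by simp)))
    rw [MvPolynomial.ringKrullDim_of_isNoetherianRing, ringKrullDim_eq_zero_of_field] at key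
    have h3 : (0 : WithBot ℕ∞) + (Nat.card (Fin 3) : WithBot ℕ∞) = 2 + 1 := by
      simp; norm_num
    rw [h3] at key
    exact (ENat.WithBot.add_le_add_one_right_iff).mp key
  · let g : MvPolynomial (Fin 3) ℚ →ₐ[ℚ] MvPolynomial (Fin 2) ℚ :=
      aeval ![C (7 / 4) * X 0, X 0, X 1]
    have h0 : g (4 * X 0 - 7 * X 1) = 0 := by
      have : (4 : MvPolynomial (Fin 2) ℚ) * C (7 / 4) = 7 := by
        rw [show (4 : MvPolynomial (Fin 2) ℚ) = C 4 from rfl, ← C_mul]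
        norm_num
        rfl
      have h4 : g 4 = 4 := map_ofNat g 4
      have h7 : g 7 = 7 := map_ofNat g 7
      have hX0 : g (X 0) = C (7 / 4) * X 0 := by simp [g]
      have hX1 : g (X 1) = X 0 := by simp [g]
      rw [map_sub, map_mul, map_mul, h4, h7, hX0, hX1, ← mul_assoc, this, sub_self]
    have hJ : ∀ x ∈ Ideal.span
          ({(4 * X 0 - 7 * X 1) * (X 0 - 2 * X 1),
            (4 * X 0 - 7 * X 1) * (316 * X 1 ^ 3 - 343 * X 2)} :
            Set (MvPolynomial (Fin 3) ℚ)), (g : MvPolynomial (Fin 3) ℚ →+* MvPolynomial (Fin 2) ℚ) x = 0 := by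
      intro x hx
      refine (Ideal.span_le (I := RingHom.ker (g : MvPolynomial (Fin 3) ℚ →+* MvPolynomial (Fin 2) ℚ))).mpr ?_ hx
      rintro y (rfl | rfl) <;>
      · change g (_ * _) = 0
        rw [map_mul, h0, zero_mul]
    have hg : Function.Surjective (g : MvPolynomial (Fin 3) ℚ →+* MvPolynomial (Fin 2) ℚ) := by
      intro p
      refine ⟨aeval ![X 1, X 2] p, ?_⟩
      have : g.comp (aeval ![X 1, X 2]) = AlgHom.id ℚ _ := by
        ext i
        fin_cases i <;> simp [g]
      exact DFunLike.congr_fun this p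
    have key := ringKrullDim_le_of_surjective _ (Ideal.Quotient.lift_surjective_of_surjective _ hJ hg)
    rw [MvPolynomial.ringKrullDim_of_isNoetherianRing, ringKrullDim_eq_zero_of_field] at key
    simpa using key
end

section
/- Let ℓ₁, …, ℓ_m be homogeneous polynomials of degree one in ℚ[x₁, …, x_k] which span the ℚ-vector space of all homogeneous degree-one polynomials. Then ℚ[x₁, …, x_k] is a finitely generated module over its ℚ-subalgebra generated by the elementary symmetric polynomials e_j(ℓ₁², …, ℓ_m²) for j = 1, …, m. -/
open MvPolynomial

set_option synthInstance.maxHeartbeats 1000000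
set_option maxHeartbeats 1000000

/-- Venkov's theorem in the form used in the paper: if `ℓ₁, …, ℓ_m` are
homogeneous degree-one polynomials in `ℚ[x₁, …, x_k]` spanning the space of all
homogeneous degree-one polynomials, then `ℚ[x₁, …, x_k]` is a finitely generated
module over the ℚ-subalgebra generated by the elementary symmetric polynomials
`e_j(ℓ₁², …, ℓ_m²)` for `j = 1, …, m`. -/
theorem finite_over_esymm_of_squares (k m : ℕ)
    (ℓ : Fin m → MvPolynomial (Fin k) ℚ)
    (hdeg : ∀ i, (ℓ i).IsHomogeneous 1)
    (hspan : ∀ f : MvPolynomial (Fin k) ℚ, f.IsHomogeneous 1 →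
      f ∈ Submodule.span ℚ (Set.range ℓ)) :
    Module.Finite
      (Algebra.adjoin ℚ
        { q : MvPolynomial (Fin k) ℚ |
          ∃ j : ℕ, 1 ≤ j ∧ j ≤ m ∧
            q = ∑ S ∈ Finset.powersetCard j (Finset.univ : Finset (Fin m)),
                  ∏ i ∈ S, (ℓ i) ^ 2 })
      (MvPolynomial (Fin k) ℚ) := by
  set A := Algebra.adjoin ℚ
        { q : MvPolynomial (Fin k) ℚ |
          ∃ j : ℕ, 1 ≤ j ∧ j ≤ m ∧
            q = ∑ S ∈ Finset.powersetCard j (Finset.univ : Finset (Fin m)),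
                  ∏ i ∈ S, (ℓ i) ^ 2 } with hA
  let s : Multiset (MvPolynomial (Fin k) ℚ) :=
    (Finset.univ : Finset (Fin m)).val.map (fun i => (ℓ i) ^ 2)
  have hcard : s.card = m := by simp [s]
  have hes : ∀ j, j ≤ m → s.esymm j ∈ A := by
    intro j hj
    have e : s.esymm j = ∑ S ∈ Finset.powersetCard j (Finset.univ : Finset (Fin m)),
        ∏ i ∈ S, (ℓ i) ^ 2 := Finset.esymm_map_val _ _ _
    rcases Nat.eq_zero_or_pos j with h0 | h0
    · subst h0
      rw [e]
      simp
    · exact Algebra.subset_adjoin ⟨j, h0, hj, e⟩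
  let P : Polynomial (MvPolynomial (Fin k) ℚ) := (s.map (fun t => Polynomial.X - Polynomial.C t)).prod
  have hPm : P.Monic := Polynomial.monic_multiset_prod_of_monic _ _
    (fun t _ => Polynomial.monic_X_sub_C t)
  have hPl : P ∈ Polynomial.lifts (algebraMap A (MvPolynomial (Fin k) ℚ)) := by
    have e : P = _ := Multiset.prod_X_sub_X_eq_sum_esymm s
    rw [e]
    refine Subsemiring.sum_mem _ fun j hj => ?_
    have hj' : j ≤ m := by
      have := Finset.mem_range.1 hj
      omega
    have h1 : Polynomial.C (s.esymm j) ∈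
        Polynomial.lifts (algebraMap A (MvPolynomial (Fin k) ℚ)) :=
      Polynomial.C_mem_lifts (algebraMap A (MvPolynomial (Fin k) ℚ)) ⟨s.esymm j, hes j hj'⟩
    have h2 : (-1 : Polynomial (MvPolynomial (Fin k) ℚ)) ∈
        Polynomial.lifts (algebraMap A (MvPolynomial (Fin k) ℚ)) := by
      rw [Polynomial.mem_lifts]
      exact ⟨-1, by simp⟩
    exact Subsemiring.mul_mem _ (Subsemiring.pow_mem _ h2 _)
      (Subsemiring.mul_mem _ h1 (Polynomial.X_pow_mem_lifts _ _))
  obtain ⟨q, hq, -, hqm⟩ := Polynomial.lifts_and_natDegree_eq_and_monic hPl hPm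
  have hint : ∀ i, IsIntegral A (ℓ i) := by
    intro i
    refine IsIntegral.of_pow (n := 2) (by norm_num) ⟨q, hqm, ?_⟩
    rw [← Polynomial.eval_map, hq, Polynomial.eval_multiset_prod]
    apply Multiset.prod_eq_zero
    rw [Multiset.map_map, Multiset.mem_map]
    exact ⟨(ℓ i) ^ 2, Multiset.mem_map.2 ⟨i, by simp, rfl⟩, by simp⟩
  have hC : ∀ c : ℚ, IsIntegral A (C c : MvPolynomial (Fin k) ℚ) := fun c =>
    isIntegral_algebraMap (R := A) (x := algebraMap ℚ A c)
  have hX : ∀ i, IsIntegral A (X i : MvPolynomial (Fin k) ℚ) := by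
    intro i
    have := hspan (X i) (isHomogeneous_X _ _)
    generalize (X i : MvPolynomial (Fin k) ℚ) = f at this ⊢
    induction this using Submodule.span_induction with
    | mem x h => obtain ⟨j, rfl⟩ := h; exact hint j
    | zero => exact isIntegral_zero
    | add x y _ _ hx hy => exact hx.add hy
    | smul a x _ hx => rw [MvPolynomial.smul_eq_C_mul]; exact (hC a).mul hx
  have : Algebra.IsIntegral A (MvPolynomial (Fin k) ℚ) := by
    refine ⟨fun p => ?_⟩
    induction p using MvPolynomial.induction_on with
    | C a => exact hC a
    | add p q hp hq => exact hp.add hq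
    | mul_X p i hp => exact hp.mul (hX i)
  have : Algebra.FiniteType A (MvPolynomial (Fin k) ℚ) :=
    Algebra.FiniteType.of_restrictScalars_finiteType ℚ A _
  exact Algebra.IsIntegral.finite
end
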